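/- For every ε ∈ (0,1) there exists a constant A = A(ε) such that for every ε-sparse family 𝒮 ⊆ 𝒟, every weight w on [0,1) with dyadic A₂ characteristic [w]_{A₂} < ∞, every measurable set E ⊆ [0,1), and every λ > 0, one has λ² · w({x ∈ [0,1) : S^sp_𝒮(w^{-1} 1_E)(x) > λ}) ≤ A [w]_{A₂} ∫_E w^{-1} dx; that is, the restricted weak type of S^sp_𝒮 ∘ M_{w^{-1}} from L²(w^{-1}) to L^{2,∞}(w) is bounded by A^{1/2} [w]_{A₂}^{1/2}. -/

import Mathlib

open MeasureTheory

noncomputable section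

/-- The dyadic interval `[k/2^n, (k+1)/2^n)`. -/
def dyadicI (n k : ℕ) : Set ℝ := Set.Ico ((k : ℝ) / 2 ^ n) (((k : ℝ) + 1) / 2 ^ n)

/-- The length of a dyadic interval of generation `n`. -/
def dyadicLen (n : ℕ) : ℝ := 1 / 2 ^ n

/-- The average `⟨f⟩_I` of `f` over the dyadic interval `I = (n,k)`. -/
def avg (f : ℝ → ℝ) (n k : ℕ) : ℝ := (2 : ℝ) ^ n * ∫ x in dyadicI n k, f x

/-- A family `𝒮` of dyadic intervals of `[0,1)` (encoded by pairs `(n,k)`, `k < 2^n`) is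
`ε`-sparse: for every `J ∈ 𝒮`, `Σ_{I ∈ 𝒮, I ⊊ J} |I| ≤ ε |J|` (expressed through all finite
subfamilies). -/
def IsSparse (ε : ℝ) (𝒮 : Set (ℕ × ℕ)) : Prop :=
  (∀ p ∈ 𝒮, p.2 < 2 ^ p.1) ∧
  ∀ p ∈ 𝒮, ∀ F : Finset (ℕ × ℕ),
    (∀ q ∈ F, q ∈ 𝒮 ∧ dyadicI q.1 q.2 ⊂ dyadicI p.1 p.2) →
    ∑ q ∈ F, dyadicLen q.1 ≤ ε * dyadicLen p.1

/-- The square of the sparse square function, `(S^sp_𝒮 φ(x))² = Σ_{I∈𝒮} ⟨|φ|⟩_I² 1_I(x)`,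
valued in `ℝ≥0∞`. -/
def sparseSqSq (𝒮 : Set (ℕ × ℕ)) (φ : ℝ → ℝ) (x : ℝ) : ENNReal :=
  ∑' p : 𝒮, Set.indicator (dyadicI p.1.1 p.1.2)
    (fun _ => ENNReal.ofReal ((avg (fun y => |φ y|) p.1.1 p.1.2) ^ 2)) x

/-- The number of members of `F` strictly containing the dyadic interval `p`. -/
def dyadicDepth (F : Finset (ℕ × ℕ)) (p : ℕ × ℕ) : ℕ :=
  open Classical in (F.filter fun q => dyadicI p.1 p.2 ⊂ dyadicI q.1 q.2).card

lemma dyadicLen_pos (n : ℕ) : 0 < dyadicLen n := by unfold dyadicLen; positivity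

lemma mem_dyadicI_iff {n k : ℕ} {x : ℝ} :
    x ∈ dyadicI n k ↔ 0 ≤ x ∧ ⌊x * 2 ^ n⌋₊ = k := by
  have h2 : (0 : ℝ) < 2 ^ n := by positivity
  unfold dyadicI
  rw [Set.mem_Ico, div_le_iff₀ h2, lt_div_iff₀ h2]
  constructor
  · rintro ⟨h1, h3⟩
    have hx : 0 ≤ x * 2 ^ n := le_trans (Nat.cast_nonneg k) h1
    exact ⟨nonneg_of_mul_nonneg_left hx h2, (Nat.floor_eq_iff hx).2 ⟨h1, h3⟩⟩
  · rintro ⟨h1, h3⟩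
    exact (Nat.floor_eq_iff (by positivity)).1 h3

lemma volume_dyadicI (n k : ℕ) : volume (dyadicI n k) = ENNReal.ofReal (dyadicLen n) := by
  unfold dyadicI dyadicLen
  rw [Real.volume_Ico]
  congr 1
  ring

lemma measurableSet_dyadicI (n k : ℕ) : MeasurableSet (dyadicI n k) := measurableSet_Ico

lemma dyadicI_nonempty (n k : ℕ) : (dyadicI n k).Nonempty := by
  unfold dyadicI
  rw [Set.nonempty_Ico]
  gcongr
  linarith

lemma dyadicI_subset_Ico {n k : ℕ} (hk : k < 2 ^ n) : dyadicI n k ⊆ Set.Ico 0 1 := by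
  have h2 : (0 : ℝ) < 2 ^ n := by positivity
  unfold dyadicI
  refine Set.Ico_subset_Ico (by positivity) ?_
  rw [div_le_one h2]
  exact_mod_cast hk

lemma dyadicI_subset_of_mem {n k m l : ℕ} (hnm : n ≤ m) {x : ℝ} (hx : x ∈ dyadicI n k)
    (hx' : x ∈ dyadicI m l) : dyadicI m l ⊆ dyadicI n k := by
  have key : ∀ y : ℝ, ⌊y * 2 ^ n⌋₊ = ⌊y * 2 ^ m⌋₊ / 2 ^ (m - n) := by
    intro y
    rw [← Nat.floor_div_natCast]
    congr 1
    push_cast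
    rw [eq_div_iff (by positivity), mul_assoc, ← pow_add, Nat.add_sub_cancel' hnm]
  intro y hy
  rw [mem_dyadicI_iff] at *
  refine ⟨hy.1, ?_⟩
  rw [key, hy.2, ← hx'.2, ← key, hx.2]

lemma dyadicI_ssubset_of_mem {p q : ℕ × ℕ} (hpq : p ≠ q) (hle : p.1 ≤ q.1) {x : ℝ}
    (hx : x ∈ dyadicI p.1 p.2) (hx' : x ∈ dyadicI q.1 q.2) :
    dyadicI q.1 q.2 ⊂ dyadicI p.1 p.2 := by
  refine ⟨dyadicI_subset_of_mem hle hx hx', fun hsub => ?_⟩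
  have hv := measure_mono (μ := volume) hsub
  rw [volume_dyadicI, volume_dyadicI, ENNReal.ofReal_le_ofReal_iff (dyadicLen_pos _).le] at hv
  unfold dyadicLen at hv
  have h1 : (2 : ℝ) ^ q.1 ≤ 2 ^ p.1 :=
    (one_div_le_one_div (by positivity) (by positivity)).1 hv
  have h2 : q.1 ≤ p.1 := (pow_le_pow_iff_right₀ (by norm_num)).1 h1
  have h3 : p.1 = q.1 := le_antisymm hle h2
  apply hpq
  rw [mem_dyadicI_iff] at hx hx'
  refine Prod.ext h3 ?_
  rw [← hx.2, ← hx'.2, h3]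

lemma exists_dyadicDepth_eq_of_succ {F : Finset (ℕ × ℕ)} {p : ℕ × ℕ} {d : ℕ}
    (h : dyadicDepth F p = d + 1) :
    ∃ q ∈ F, dyadicI p.1 p.2 ⊂ dyadicI q.1 q.2 ∧ dyadicDepth F q = d := by
  classical
  set G := F.filter fun q => dyadicI p.1 p.2 ⊂ dyadicI q.1 q.2 with hG
  have hcard : G.card = d + 1 := by rw [← h, hG]; unfold dyadicDepth; congr
  have hne : G.Nonempty := by rw [← Finset.card_pos]; omega
  obtain ⟨q, hqG, hq⟩ := Finset.exists_max_image G Prod.fst hne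
  have hqF := Finset.mem_filter.1 hqG
  refine ⟨q, hqF.1, hqF.2, ?_⟩
  have : (F.filter fun r => dyadicI q.1 q.2 ⊂ dyadicI r.1 r.2) = G.erase q := by
    ext r
    rw [Finset.mem_erase, Finset.mem_filter, hG, Finset.mem_filter]
    constructor
    · rintro ⟨hr, hqr⟩
      refine ⟨?_, hr, hqF.2.trans hqr⟩
      rintro rfl
      exact hqr.ne rfl
    · rintro ⟨hrq, hr, hpr⟩
      obtain ⟨x, hx⟩ := dyadicI_nonempty p.1 p.2
      exact ⟨hr, dyadicI_ssubset_of_mem hrq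
        (hq r (Finset.mem_filter.2 ⟨hr, hpr⟩)) (hpr.subset hx) (hqF.2.subset hx)⟩
  have h2 : dyadicDepth F q = (G.erase q).card := by rw [← this]; unfold dyadicDepth; congr
  rw [h2, Finset.card_erase_of_mem hqG, hcard, Nat.add_sub_cancel]

lemma exists_dyadicDepth_eq_of_le {F : Finset (ℕ × ℕ)} {m : ℕ} :
    ∀ (d : ℕ) {p : ℕ × ℕ}, p ∈ F → dyadicDepth F p = m + d →
      ∃ q ∈ F, dyadicI p.1 p.2 ⊆ dyadicI q.1 q.2 ∧ dyadicDepth F q = m := by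
  intro d
  induction d with
  | zero => exact fun hp h => ⟨_, hp, subset_rfl, h⟩
  | succ d ih =>
    intro p hp h
    obtain ⟨q, hq, hpq, hd⟩ := exists_dyadicDepth_eq_of_succ (d := m + d) h
    obtain ⟨r, hr, hqr, hrd⟩ := ih hq hd
    exact ⟨r, hr, hpq.subset.trans hqr, hrd⟩

open Classical in
lemma exists_mem_dyadicDepth_eq {F : Finset (ℕ × ℕ)} {m : ℕ} {x : ℝ}
    (h : m < (F.filter fun p => x ∈ dyadicI p.1 p.2).card) :
    ∃ p ∈ F, x ∈ dyadicI p.1 p.2 ∧ dyadicDepth F p = m := by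
  set G := F.filter fun p => x ∈ dyadicI p.1 p.2 with hG
  have hne : G.Nonempty := by rw [← Finset.card_pos]; omega
  obtain ⟨p, hpG, hp⟩ := Finset.exists_max_image G Prod.fst hne
  have hpF := Finset.mem_filter.1 hpG
  have hsub : G.erase p ⊆ F.filter fun q => dyadicI p.1 p.2 ⊂ dyadicI q.1 q.2 := by
    intro q hq
    rw [Finset.mem_erase] at hq
    have hqF := Finset.mem_filter.1 hq.2
    exact Finset.mem_filter.2
      ⟨hqF.1, dyadicI_ssubset_of_mem hq.1 (hp q hq.2) hqF.2 hpF.2⟩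
  have hle : m ≤ dyadicDepth F p := by
    have := Finset.card_le_card hsub
    rw [Finset.card_erase_of_mem hpG] at this
    unfold dyadicDepth
    omega
  obtain ⟨d, hd⟩ := Nat.exists_eq_add_of_le hle
  obtain ⟨q, hq, hpq, hqd⟩ := exists_dyadicDepth_eq_of_le d hpF.1 hd
  exact ⟨q, hq, hpq hpF.2, hqd⟩

lemma sum_biUnion_le_of_nonneg {ι κ : Type*} [DecidableEq κ] (s : Finset ι) (t : ι → Finset κ)
    {f : κ → ℝ} (hf : ∀ k, 0 ≤ f k) :
    ∑ k ∈ s.biUnion t, f k ≤ ∑ i ∈ s, ∑ k ∈ t i, f k := by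
  classical
  induction s using Finset.induction_on with
  | empty => simp
  | insert i s hi ih =>
    rw [Finset.biUnion_insert, Finset.sum_insert hi]
    have h1 := Finset.sum_union_inter (s₁ := t i) (s₂ := s.biUnion t) (f := f)
    have h2 : 0 ≤ ∑ k ∈ t i ∩ s.biUnion t, f k := Finset.sum_nonneg fun k _ => hf k
    linarith

/-- In a sparse family the total length decays geometrically with the depth. -/
lemma IsSparse.sum_dyadicLen_depth_le {ε : ℝ} (hε : 0 ≤ ε) {𝒮 : Set (ℕ × ℕ)}
    (h𝒮 : IsSparse ε 𝒮) {F : Finset (ℕ × ℕ)} (hF : ↑F ⊆ 𝒮) (m : ℕ) :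
    ∑ p ∈ F with dyadicDepth F p = m, dyadicLen p.1 ≤
      ε ^ m * ∑ p ∈ F with dyadicDepth F p = 0, dyadicLen p.1 := by
  classical
  induction m with
  | zero => simp
  | succ m ih =>
    calc ∑ p ∈ F with dyadicDepth F p = m + 1, dyadicLen p.1
        ≤ ∑ p ∈ (F.filter fun q => dyadicDepth F q = m).biUnion
            (fun q => F.filter fun p => dyadicI p.1 p.2 ⊂ dyadicI q.1 q.2), dyadicLen p.1 := by
          refine Finset.sum_le_sum_of_subset_of_nonneg ?_ fun p _ _ => (dyadicLen_pos _).le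
          intro p hp
          obtain ⟨hpF, hpd⟩ := Finset.mem_filter.1 hp
          obtain ⟨q, hq, hpq, hqd⟩ := exists_dyadicDepth_eq_of_succ hpd
          exact Finset.mem_biUnion.2
            ⟨q, Finset.mem_filter.2 ⟨hq, hqd⟩, Finset.mem_filter.2 ⟨hpF, hpq⟩⟩
      _ ≤ ∑ q ∈ F with dyadicDepth F q = m,
            ∑ p ∈ F with dyadicI p.1 p.2 ⊂ dyadicI q.1 q.2, dyadicLen p.1 :=
          sum_biUnion_le_of_nonneg _ _ fun p => (dyadicLen_pos p.1).le
      _ ≤ ∑ q ∈ F with dyadicDepth F q = m, ε * dyadicLen q.1 := by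
          refine Finset.sum_le_sum fun q hq => h𝒮.2 q (hF (Finset.mem_filter.1 hq).1) _ ?_
          intro p hp
          obtain ⟨hpF, hpq⟩ := Finset.mem_filter.1 hp
          exact ⟨hF hpF, hpq⟩
      _ ≤ ε ^ (m + 1) * ∑ p ∈ F with dyadicDepth F p = 0, dyadicLen p.1 := by
          rw [← Finset.mul_sum, pow_succ', mul_assoc]
          exact mul_le_mul_of_nonneg_left ih hε

/-- The members of depth zero are disjoint. -/
lemma sum_setIntegral_depth_zero_le {F : Finset (ℕ × ℕ)} (hF : ∀ p ∈ F, p.2 < 2 ^ p.1)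
    {f : ℝ → ℝ} (hf : ∀ x, 0 ≤ f x) (hfi : IntegrableOn f (Set.Ico 0 1)) :
    ∑ p ∈ F with dyadicDepth F p = 0, ∫ x in dyadicI p.1 p.2, f x ≤
      ∫ x in Set.Ico 0 1, f x := by
  classical
  have hmem : ∀ p ∈ F.filter (fun p => dyadicDepth F p = 0), p ∈ F ∧ dyadicDepth F p = 0 :=
    fun p hp => Finset.mem_filter.1 hp
  have hnot : ∀ p q : ℕ × ℕ, q ∈ F → dyadicDepth F p = 0 →
      ¬ dyadicI p.1 p.2 ⊂ dyadicI q.1 q.2 := by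
    intro p q hq hp
    unfold dyadicDepth at hp
    rw [Finset.card_eq_zero, Finset.filter_eq_empty_iff] at hp
    exact hp hq
  rw [← integral_biUnion_finset]
  · refine setIntegral_mono_set hfi (Filter.Eventually.of_forall hf)
      (LE.le.eventuallyLE ?_)
    exact Set.iUnion₂_subset fun p hp => dyadicI_subset_Ico (hF p (hmem p hp).1)
  · exact fun p _ => measurableSet_dyadicI _ _
  · intro p hp q hq hpq
    rw [Finset.mem_coe] at hp hq
    refine Set.disjoint_left.2 fun x hxp hxq => ?_
    rcases le_total p.1 q.1 with h | h
    · exact hnot q p (hmem p hp).1 (hmem q hq).2 (dyadicI_ssubset_of_mem hpq h hxp hxq)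
    · exact hnot p q (hmem q hq).1 (hmem p hp).2 (dyadicI_ssubset_of_mem hpq.symm h hxq hxp)
  · exact fun p hp => hfi.mono_set (dyadicI_subset_Ico (hF p (hmem p hp).1))

lemma setIntegral_dyadicI_eq (f : ℝ → ℝ) (n k : ℕ) :
    ∫ x in dyadicI n k, f x = avg f n k * dyadicLen n := by
  unfold avg dyadicLen
  field_simp

lemma sum_setIntegral_weight_depth_le {ε : ℝ} (hε : 0 ≤ ε) {𝒮 : Set (ℕ × ℕ)}
    (h𝒮 : IsSparse ε 𝒮) {F : Finset (ℕ × ℕ)} (hF : ↑F ⊆ 𝒮) {w f : ℝ → ℝ} {Q t : ℝ}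
    (hQ : 0 ≤ Q) (ht : 0 < t) (hf : ∀ x, 0 ≤ f x) (hfi : IntegrableOn f (Set.Ico 0 1))
    (hFt : ∀ p ∈ F, t ≤ avg f p.1 p.2)
    (hFw : ∀ p ∈ F, avg w p.1 p.2 * avg f p.1 p.2 ≤ Q) (m : ℕ) :
    ∑ p ∈ F with dyadicDepth F p = m, ∫ x in dyadicI p.1 p.2, w x ≤
      Q / t ^ 2 * ε ^ m * ∫ x in Set.Ico 0 1, f x := by
  have hbound : ∀ p ∈ F, ∫ x in dyadicI p.1 p.2, w x ≤ Q / t * dyadicLen p.1 := by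
    intro p hp
    rw [setIntegral_dyadicI_eq]
    refine mul_le_mul_of_nonneg_right ?_ (dyadicLen_pos _).le
    have h1 := hFt p hp
    calc avg w p.1 p.2 ≤ Q / avg f p.1 p.2 := (le_div_iff₀ (ht.trans_le h1)).2 (hFw p hp)
      _ ≤ Q / t := by gcongr
  have hlen : ∀ p ∈ F, dyadicLen p.1 ≤ t⁻¹ * ∫ x in dyadicI p.1 p.2, f x := by
    intro p hp
    rw [setIntegral_dyadicI_eq, le_inv_mul_iff₀ ht]
    exact mul_le_mul_of_nonneg_right (hFt p hp) (dyadicLen_pos _).le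
  calc ∑ p ∈ F with dyadicDepth F p = m, ∫ x in dyadicI p.1 p.2, w x
      ≤ ∑ p ∈ F with dyadicDepth F p = m, Q / t * dyadicLen p.1 :=
        Finset.sum_le_sum fun p hp => hbound p (Finset.mem_filter.1 hp).1
    _ = Q / t * ∑ p ∈ F with dyadicDepth F p = m, dyadicLen p.1 := by rw [Finset.mul_sum]
    _ ≤ Q / t * (ε ^ m * ∑ p ∈ F with dyadicDepth F p = 0, dyadicLen p.1) := by
        gcongr
        exact h𝒮.sum_dyadicLen_depth_le hε hF m
    _ ≤ Q / t * (ε ^ m * ∑ p ∈ F with dyadicDepth F p = 0,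
          t⁻¹ * ∫ x in dyadicI p.1 p.2, f x) := by
        gcongr with p hp
        exact hlen p (Finset.mem_filter.1 hp).1
    _ ≤ Q / t * (ε ^ m * (t⁻¹ * ∫ x in Set.Ico 0 1, f x)) := by
        rw [← Finset.mul_sum]
        gcongr
        exact sum_setIntegral_depth_zero_le (fun p hp => h𝒮.1 p (hF hp)) hf hfi
    _ = _ := by field_simp

lemma sum_range_two_pow_sub_one_div_four_pow_le (J : ℕ) :
    ∑ j ∈ Finset.range J, ((2 : ℝ) ^ j - 1) / 4 ^ j ≤ 1 := by
  have h : ∑ j ∈ Finset.range J, ((2 : ℝ) ^ j - 1) / 4 ^ j =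
      2 / 3 - 2 * (1 / 2 ^ J) + 4 / 3 * (1 / 2 ^ J) ^ 2 := by
    induction J with
    | zero => norm_num
    | succ J ih =>
      rw [Finset.sum_range_succ, ih, show (4 : ℝ) = 2 ^ 2 by norm_num, ← pow_mul, pow_succ]
      field_simp
      ring
  rw [h]
  have h0 : (0 : ℝ) ≤ 1 / 2 ^ J := by positivity
  have h1 : (1 : ℝ) / 2 ^ J ≤ 1 := by
    rw [div_le_one (by positivity)]
    exact one_le_pow₀ (by norm_num)
  nlinarith

/-- If a sum of squares is large then, at some scale, many of its terms are. -/
lemma exists_two_pow_le_card {ι : Type*} (G : Finset ι) (a : ι → ℝ) (ha : ∀ p, 0 ≤ a p)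
    {lam : ℝ} (hlam : 0 < lam) (h : lam ^ 2 < ∑ p ∈ G, a p ^ 2) :
    ∃ j : ℕ, 2 ^ j ≤ (G.filter fun p => lam / 2 ^ (j + 1) < a p).card := by
  classical
  by_contra! hcon
  have hex : ∀ p, 0 < a p → ∃ j : ℕ, lam / 2 ^ (j + 1) < a p := by
    intro p hp
    obtain ⟨n, hn⟩ := exists_pow_lt_of_lt_one (div_pos hp hlam) (by norm_num : (1 / 2 : ℝ) < 1)
    refine ⟨n, ?_⟩
    rw [lt_div_iff₀ hlam] at hn
    refine lt_of_le_of_lt ?_ hn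
    rw [one_div, inv_pow, mul_comm, ← div_eq_mul_inv]
    gcongr <;> norm_num
  choose! c hc using fun p hp => (⟨Nat.find (hex p hp), Nat.find_spec (hex p hp),
    fun m hm => Nat.find_min (hex p hp) hm⟩ :
      ∃ j : ℕ, lam / 2 ^ (j + 1) < a p ∧ ∀ m < j, ¬ lam / 2 ^ (m + 1) < a p)
  set G' := G.filter fun p => 0 < a p with hG'
  have hpos : ∀ p ∈ G', p ∈ G ∧ 0 < a p := fun p hp => Finset.mem_filter.1 hp
  have hc0 : ∀ p ∈ G', c p ≠ 0 := by
    intro p hp h0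
    have h1 := hcon 0
    have h2 := (hc p (hpos p hp).2).1
    rw [h0] at h2
    rw [pow_zero, Nat.lt_one_iff, Finset.card_eq_zero, Finset.filter_eq_empty_iff] at h1
    exact h1 (hpos p hp).1 h2
  have hle : ∀ p ∈ G', a p ^ 2 ≤ lam ^ 2 / 4 ^ c p := by
    intro p hp
    obtain ⟨m, hm⟩ := Nat.exists_eq_succ_of_ne_zero (hc0 p hp)
    have h1 := (hc p (hpos p hp).2).2 m (by omega)
    rw [not_lt, ← Nat.succ_eq_add_one, ← hm] at h1
    calc a p ^ 2 ≤ (lam / 2 ^ c p) ^ 2 := pow_le_pow_left₀ (ha p) h1 2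
      _ = lam ^ 2 / 4 ^ c p := by
        rw [div_pow, ← pow_mul, mul_comm, pow_mul]; norm_num
  have hmaps : ∀ p ∈ G', c p ∈ Finset.range (G'.sup c + 1) := fun p hp =>
    Finset.mem_range.2 (Nat.lt_succ_of_le (Finset.le_sup hp))
  have : ∑ p ∈ G, a p ^ 2 ≤ lam ^ 2 :=
    calc ∑ p ∈ G, a p ^ 2 = ∑ p ∈ G', a p ^ 2 := by
          symm
          refine Finset.sum_subset (Finset.filter_subset _ _) fun p hp hp' => ?_
          have : a p = 0 := by
            by_contra hne
            exact hp' (Finset.mem_filter.2 ⟨hp, lt_of_le_of_ne (ha p) (Ne.symm hne)⟩)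
          rw [this]; norm_num
      _ ≤ ∑ p ∈ G', lam ^ 2 / 4 ^ c p := Finset.sum_le_sum hle
      _ = ∑ j ∈ Finset.range (G'.sup c + 1), ∑ p ∈ G' with c p = j, lam ^ 2 / 4 ^ c p :=
          (Finset.sum_fiberwise_of_maps_to hmaps _).symm
      _ ≤ ∑ j ∈ Finset.range (G'.sup c + 1), lam ^ 2 * (((2 : ℝ) ^ j - 1) / 4 ^ j) := by
          refine Finset.sum_le_sum fun j _ => ?_
          have h1 : ∑ p ∈ G' with c p = j, lam ^ 2 / 4 ^ c p =
              ∑ p ∈ G' with c p = j, lam ^ 2 / 4 ^ j :=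
            Finset.sum_congr rfl fun p hp => by rw [(Finset.mem_filter.1 hp).2]
          have h2 : (G'.filter fun p => c p = j).card + 1 ≤ 2 ^ j := by
            refine lt_of_le_of_lt (Finset.card_le_card ?_) (hcon j)
            intro p hp
            obtain ⟨hpG, hpj⟩ := Finset.mem_filter.1 hp
            refine Finset.mem_filter.2 ⟨(hpos p hpG).1, ?_⟩
            rw [← hpj]
            exact (hc p (hpos p hpG).2).1
          have h3 : ((G'.filter fun p => c p = j).card : ℝ) ≤ 2 ^ j - 1 := by
            have : (((G'.filter fun p => c p = j).card + 1 : ℕ) : ℝ) ≤ ((2 ^ j : ℕ) : ℝ) :=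
              Nat.cast_le.2 h2
            push_cast at this
            linarith
          rw [h1, Finset.sum_const, nsmul_eq_mul]
          calc _ ≤ ((2 : ℝ) ^ j - 1) * (lam ^ 2 / 4 ^ j) := by gcongr
            _ = _ := by ring
      _ ≤ lam ^ 2 := by
          rw [← Finset.mul_sum]
          exact mul_le_of_le_one_right (by positivity)
            (sum_range_two_pow_sub_one_div_four_pow_le _)
  exact absurd h this.not_gt

lemma summable_four_pow_mul_pow {ε : ℝ} (h0 : 0 < ε) (h1 : ε < 1) :
    Summable fun j : ℕ => (4 : ℝ) ^ (j + 1) * ε ^ (2 ^ j - 1) := by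
  refine summable_of_ratio_test_tendsto_lt_one (l := 0) one_pos
    (Filter.Eventually.of_forall fun j => by positivity) ?_
  have h : (fun j : ℕ => ‖(4 : ℝ) ^ (j + 1 + 1) * ε ^ (2 ^ (j + 1) - 1)‖ /
      ‖(4 : ℝ) ^ (j + 1) * ε ^ (2 ^ j - 1)‖) = fun j : ℕ => 4 * ε ^ (2 ^ j) := by
    funext j
    rw [Real.norm_of_nonneg (by positivity), Real.norm_of_nonneg (by positivity),
      div_eq_iff (by positivity)]
    have : 2 ^ (j + 1) - 1 = 2 ^ j + (2 ^ j - 1) := by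
      have := Nat.one_le_two_pow (n := j)
      rw [pow_succ]
      omega
    rw [this, pow_add ε, pow_succ _ (j + 1)]
    ring
  rw [h]
  have := ((tendsto_pow_atTop_nhds_zero_of_lt_one h0.le h1).comp
    (tendsto_pow_atTop_atTop_of_one_lt (r := 2) (by norm_num : 1 < 2))).const_mul (4 : ℝ)
  simpa using this

/-- The restricted weak type bound for a finite sparse family. -/
lemma measure_sum_sq_avg_gt_le {ε : ℝ} (hε : 0 < ε) (hε1 : ε < 1) {𝒮 : Set (ℕ × ℕ)}
    (h𝒮 : IsSparse ε 𝒮) {F : Finset (ℕ × ℕ)} (hF : ↑F ⊆ 𝒮) {w f : ℝ → ℝ} {Q lam : ℝ}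
    (hw : ∀ x ∈ Set.Ico (0 : ℝ) 1, 0 < w x) (hwi : IntegrableOn w (Set.Ico 0 1))
    (hQ : 0 ≤ Q) (hlam : 0 < lam) (hf : ∀ x, 0 ≤ f x) (hfi : IntegrableOn f (Set.Ico 0 1))
    (hFw : ∀ p ∈ F, avg w p.1 p.2 * avg f p.1 p.2 ≤ Q) :
    (volume.withDensity fun x => ENNReal.ofReal (w x))
      {x | lam ^ 2 < ∑ p ∈ F, (dyadicI p.1 p.2).indicator (fun _ => avg f p.1 p.2 ^ 2) x} ≤
      ENNReal.ofReal ((∑' j : ℕ, (4 : ℝ) ^ (j + 1) * ε ^ (2 ^ j - 1)) *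
        (Q / lam ^ 2 * ∫ x in Set.Ico 0 1, f x)) := by
  classical
  set μ : Measure ℝ := volume.withDensity fun x => ENNReal.ofReal (w x)
  set I₀ : ℝ := ∫ x in Set.Ico 0 1, f x
  have hI₀ : 0 ≤ I₀ := integral_nonneg hf
  have havg : ∀ p : ℕ × ℕ, 0 ≤ avg f p.1 p.2 := fun p =>
    mul_nonneg (by positivity) (integral_nonneg hf)
  set Fj : ℕ → Finset (ℕ × ℕ) := fun j => F.filter fun p => lam / 2 ^ (j + 1) < avg f p.1 p.2
    with hFj
  have hFjF : ∀ j, ↑(Fj j) ⊆ 𝒮 := fun j p hp => hF (Finset.mem_filter.1 hp).1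
  have hcover : {x | lam ^ 2 < ∑ p ∈ F,
      (dyadicI p.1 p.2).indicator (fun _ => avg f p.1 p.2 ^ 2) x} ⊆
      ⋃ j, ⋃ p ∈ (Fj j).filter fun p => dyadicDepth (Fj j) p = 2 ^ j - 1,
        dyadicI p.1 p.2 := by
    intro x hx
    rw [Set.mem_ofPred_eq] at hx
    simp only [Set.indicator_apply] at hx
    rw [← Finset.sum_filter] at hx
    obtain ⟨j, hj⟩ := exists_two_pow_le_card _ _ havg hlam hx
    rw [Finset.filter_comm] at hj
    have hlt : 2 ^ j - 1 < ((Fj j).filter fun p => x ∈ dyadicI p.1 p.2).card :=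
      lt_of_lt_of_le (Nat.sub_lt (by positivity) one_pos) hj
    obtain ⟨p, hp, hxp, hd⟩ := exists_mem_dyadicDepth_eq hlt
    exact Set.mem_iUnion.2 ⟨j, Set.mem_iUnion₂.2 ⟨p, Finset.mem_filter.2 ⟨hp, hd⟩, hxp⟩⟩
  have hμ : ∀ p ∈ 𝒮, μ (dyadicI p.1 p.2) = ENNReal.ofReal (∫ x in dyadicI p.1 p.2, w x) := by
    intro p hp
    have hsub := dyadicI_subset_Ico (h𝒮.1 p hp)
    rw [withDensity_apply _ (measurableSet_dyadicI _ _),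
      ofReal_integral_eq_lintegral_ofReal (hwi.mono_set hsub)]
    exact ae_restrict_of_forall_mem (measurableSet_dyadicI _ _) fun x hx => (hw x (hsub hx)).le
  have hwnn : ∀ p ∈ 𝒮, 0 ≤ ∫ x in dyadicI p.1 p.2, w x := fun p hp =>
    setIntegral_nonneg (measurableSet_dyadicI _ _) fun x hx =>
      (hw x (dyadicI_subset_Ico (h𝒮.1 p hp) hx)).le
  have hlevel : ∀ j, μ (⋃ p ∈ (Fj j).filter fun p => dyadicDepth (Fj j) p = 2 ^ j - 1,
      dyadicI p.1 p.2) ≤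
      ENNReal.ofReal ((4 : ℝ) ^ (j + 1) * ε ^ (2 ^ j - 1) * (Q / lam ^ 2 * I₀)) := by
    intro j
    refine (measure_biUnion_finset_le _ _).trans ?_
    have hmem : ∀ p ∈ (Fj j).filter fun p => dyadicDepth (Fj j) p = 2 ^ j - 1, p ∈ 𝒮 :=
      fun p hp => hFjF j (Finset.mem_filter.1 hp).1
    rw [Finset.sum_congr rfl fun p hp => hμ p (hmem p hp),
      ← ENNReal.ofReal_sum_of_nonneg fun p hp => hwnn p (hmem p hp)]
    refine ENNReal.ofReal_le_ofReal ?_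
    refine (sum_setIntegral_weight_depth_le hε.le h𝒮 (hFjF j) hQ
      (t := lam / 2 ^ (j + 1)) (by positivity) hf hfi
      (fun p hp => (Finset.mem_filter.1 hp).2.le)
      (fun p hp => hFw p (Finset.mem_filter.1 hp).1) _).trans_eq ?_
    rw [div_pow, ← pow_mul, mul_comm (j + 1) 2, pow_mul]
    norm_num
    simp only [I₀]
    field_simp
  have hsum := (summable_four_pow_mul_pow hε hε1).mul_right (Q / lam ^ 2 * I₀)
  calc _ ≤ ∑' j, ENNReal.ofReal ((4 : ℝ) ^ (j + 1) * ε ^ (2 ^ j - 1) * (Q / lam ^ 2 * I₀)) :=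
        (measure_mono hcover).trans <| (measure_iUnion_le _).trans <|
          ENNReal.tsum_le_tsum hlevel
    _ = _ := by
        rw [← ENNReal.ofReal_tsum_of_nonneg (fun j => by positivity) hsum, tsum_mul_right]

lemma measurable_sparseSqSq (𝒮 : Set (ℕ × ℕ)) (φ : ℝ → ℝ) : Measurable (sparseSqSq 𝒮 φ) :=
  Measurable.tsum fun _ => measurable_const.indicator (measurableSet_dyadicI _ _)

/-- for every `ε ∈ (0,1)` there is `A = A(ε) > 0` such that for every
`ε`-sparse family `𝒮`, every weight `w` on `[0,1)` with `[w]_{A₂} ≤ Q`, every measurable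
`E ⊆ [0,1)` and every `λ > 0`,
`λ² · w({x ∈ [0,1) : S^sp_𝒮(w⁻¹ 1_E)(x) > λ}) ≤ A [w]_{A₂} ∫_E w⁻¹`; i.e. the restricted
weak type of `S^sp_𝒮 ∘ M_{w⁻¹}` from `L²(w⁻¹)` to `L^{2,∞}(w)` is at most
`A^{1/2} [w]_{A₂}^{1/2}`.  The condition `S^sp_𝒮(w⁻¹1_E)(x) > λ` is written with squares. -/
theorem sparse_restricted_weak_type :
    ∀ ε : ℝ, 0 < ε → ε < 1 →
      ∃ A : ℝ, 0 < A ∧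
        ∀ 𝒮 : Set (ℕ × ℕ), IsSparse ε 𝒮 →
        ∀ w : ℝ → ℝ, Measurable w →
          (∀ x ∈ Set.Ico (0 : ℝ) 1, 0 < w x) →
          IntegrableOn w (Set.Ico (0 : ℝ) 1) →
          IntegrableOn (fun x => (w x)⁻¹) (Set.Ico (0 : ℝ) 1) →
        ∀ Q : ℝ,
          (∀ n k : ℕ, k < 2 ^ n →
            avg w n k * avg (fun x => (w x)⁻¹) n k ≤ Q) →
        ∀ E : Set ℝ, MeasurableSet E → E ⊆ Set.Ico (0 : ℝ) 1 →
        ∀ lam : ℝ, 0 < lam →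
          lam ^ 2 *
              ∫ x in {x : ℝ | x ∈ Set.Ico (0 : ℝ) 1 ∧
                ENNReal.ofReal (lam ^ 2) <
                  sparseSqSq 𝒮
                    (fun y => (w y)⁻¹ * Set.indicator E (fun _ => (1 : ℝ)) y) x}, w x
            ≤ A * Q * ∫ x in E, (w x)⁻¹ := by
  intro ε hε hε1
  refine ⟨∑' j : ℕ, (4 : ℝ) ^ (j + 1) * ε ^ (2 ^ j - 1),
    (summable_four_pow_mul_pow hε hε1).tsum_pos (fun j => by positivity) 0 (by positivity), ?_⟩
  intro 𝒮 h𝒮 w hwm hw hwi hσi Q hQ E hE hE01 lam hlam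
  classical
  set A : ℝ := ∑' j : ℕ, (4 : ℝ) ^ (j + 1) * ε ^ (2 ^ j - 1)
  set f : ℝ → ℝ := fun y => (w y)⁻¹ * Set.indicator E (fun _ => (1 : ℝ)) y with hf_def
  have hfE : f = E.indicator fun x => (w x)⁻¹ := by
    funext y
    by_cases hy : y ∈ E <;> simp [hf_def, hy]
  have hf : ∀ x, 0 ≤ f x := by
    intro x
    rw [hfE]
    exact Set.indicator_nonneg (fun y hy => (inv_pos.2 (hw y (hE01 hy))).le) x
  have hfi : IntegrableOn f (Set.Ico 0 1) := by
    rw [hfE]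
    exact Integrable.indicator hσi hE
  have hfint : ∫ x in Set.Ico 0 1, f x = ∫ x in E, (w x)⁻¹ := by
    rw [hfE, setIntegral_indicator hE, Set.inter_eq_self_of_subset_right hE01]
  have habs : (fun y => |f y|) = f := funext fun y => abs_of_nonneg (hf y)
  have hwavg : ∀ p : ℕ × ℕ, p.2 < 2 ^ p.1 → 0 ≤ avg w p.1 p.2 := fun p hp =>
    mul_nonneg (by positivity) (setIntegral_nonneg (measurableSet_dyadicI _ _)
      fun x hx => (hw x (dyadicI_subset_Ico hp hx)).le)
  have hfavg : ∀ p : ℕ × ℕ, 0 ≤ avg f p.1 p.2 := fun p =>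
    mul_nonneg (by positivity) (integral_nonneg hf)
  have hFw : ∀ p : ℕ × ℕ, p.2 < 2 ^ p.1 → avg w p.1 p.2 * avg f p.1 p.2 ≤ Q := by
    intro p hp
    refine le_trans (mul_le_mul_of_nonneg_left ?_ (hwavg p hp)) (hQ p.1 p.2 hp)
    have hsub := dyadicI_subset_Ico hp
    refine mul_le_mul_of_nonneg_left (setIntegral_mono_on (hfi.mono_set hsub)
      (hσi.mono_set hsub) (measurableSet_dyadicI _ _) fun x hx => ?_) (by positivity)
    rw [hfE]
    exact Set.indicator_le_self' (fun _ _ => (inv_pos.2 (hw x (hsub hx))).le) x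
  have hQ0 : 0 ≤ Q :=
    (mul_nonneg (hwavg (0, 0) (by norm_num)) (hfavg (0, 0))).trans (hFw (0, 0) (by norm_num))
  set μ : Measure ℝ := volume.withDensity fun x => ENNReal.ofReal (w x) with hμ
  set FN : ℕ → Finset (ℕ × ℕ) := fun N =>
    (Finset.range N ×ˢ Finset.range N).filter fun p => p ∈ 𝒮 with hFN
  have hFNsub : ∀ N, ↑(FN N) ⊆ 𝒮 := fun N p hp => (Finset.mem_filter.1 hp).2
  set B : Set ℝ := {x : ℝ | x ∈ Set.Ico (0 : ℝ) 1 ∧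
    ENNReal.ofReal (lam ^ 2) < sparseSqSq 𝒮 f x} with hB
  set BN : ℕ → Set ℝ := fun N => {x | lam ^ 2 < ∑ p ∈ FN N,
    (dyadicI p.1 p.2).indicator (fun _ => avg f p.1 p.2 ^ 2) x} with hBN
  have hBmeas : MeasurableSet B :=
    measurableSet_Ico.inter (measurableSet_lt measurable_const (measurable_sparseSqSq 𝒮 f))
  have hmono : Monotone BN := by
    intro M N hMN x hx
    rw [hBN, Set.mem_ofPred_eq] at hx ⊢
    refine lt_of_lt_of_le hx (Finset.sum_le_sum_of_subset_of_nonneg ?_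
      fun p _ _ => Set.indicator_nonneg (fun _ _ => sq_nonneg _) x)
    refine Finset.filter_subset_filter _ (Finset.product_subset_product ?_ ?_) <;>
      exact Finset.range_mono hMN
  have hBsub : B ⊆ ⋃ N, BN N := by
    rintro x ⟨-, hx⟩
    unfold sparseSqSq at hx
    rw [habs, ENNReal.tsum_eq_iSup_sum, lt_iSup_iff] at hx
    obtain ⟨s, hs⟩ := hx
    obtain ⟨N, hN⟩ : ∃ N, s.image Subtype.val ⊆ FN N := by
      refine ⟨(s.image Subtype.val).sup (fun p => p.1 + p.2) + 1, fun p hp => ?_⟩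
      have hle := Finset.le_sup (f := fun p : ℕ × ℕ => p.1 + p.2) hp
      obtain ⟨q, -, rfl⟩ := Finset.mem_image.1 hp
      refine Finset.mem_filter.2 ⟨Finset.mem_product.2 ?_, q.2⟩
      simp only [Finset.mem_range] at *
      omega
    refine Set.mem_iUnion.2 ⟨N, ?_⟩
    rw [hBN, Set.mem_ofPred_eq]
    have hterm : ∀ p : ℕ × ℕ, Set.indicator (dyadicI p.1 p.2)
        (fun _ => ENNReal.ofReal (avg f p.1 p.2 ^ 2)) x =
        ENNReal.ofReal ((dyadicI p.1 p.2).indicator (fun _ => avg f p.1 p.2 ^ 2) x) := by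
      intro p
      by_cases hp : x ∈ dyadicI p.1 p.2 <;> simp [hp]
    have hnn : ∀ p : ℕ × ℕ,
        0 ≤ (dyadicI p.1 p.2).indicator (fun _ => avg f p.1 p.2 ^ 2) x :=
      fun p => Set.indicator_nonneg (fun _ _ => sq_nonneg _) x
    rw [Finset.sum_congr rfl fun p _ => hterm p.1,
      ← ENNReal.ofReal_sum_of_nonneg fun p _ => hnn p.1] at hs
    refine (ENNReal.ofReal_lt_ofReal_iff'.1 hs).1.trans_le ?_
    rw [← Finset.sum_image (s := s) (g := Subtype.val)
      (f := fun p : ℕ × ℕ => (dyadicI p.1 p.2).indicator (fun _ => avg f p.1 p.2 ^ 2) x)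
      Subtype.val_injective.injOn]
    exact Finset.sum_le_sum_of_subset_of_nonneg hN fun p _ _ => hnn p
  have hμB : μ B ≤ ENNReal.ofReal (A * (Q / lam ^ 2 * ∫ x in Set.Ico 0 1, f x)) := by
    refine (measure_mono hBsub).trans ?_
    rw [hmono.measure_iUnion]
    exact iSup_le fun N => measure_sum_sq_avg_gt_le hε hε1 h𝒮 (hFNsub N) hw hwi hQ0 hlam hf hfi
      fun p hp => hFw p (h𝒮.1 p (hFNsub N hp))
  have hIB : ∫ x in B, w x ≤ A * (Q / lam ^ 2 * ∫ x in Set.Ico 0 1, f x) := by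
    have hA0 : 0 ≤ A := tsum_nonneg fun j => by positivity
    have hI : 0 ≤ ∫ x in Set.Ico 0 1, f x := integral_nonneg hf
    rw [hμ, withDensity_apply _ hBmeas, ← ofReal_integral_eq_lintegral_ofReal
      (hwi.mono_set fun x hx => hx.1)
      (ae_restrict_of_forall_mem hBmeas fun x hx => (hw x hx.1).le)] at hμB
    exact (ENNReal.ofReal_le_ofReal_iff (by positivity)).1 hμB
  rw [hfint] at hIB
  calc lam ^ 2 * ∫ x in B, w x ≤ lam ^ 2 * (A * (Q / lam ^ 2 * ∫ x in E, (w x)⁻¹)) := by gcongr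
    _ = A * Q * ∫ x in E, (w x)⁻¹ := by field_simp
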